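/- arXiv:0901.0071 — 6 statements merged into one kernel-verified Lean document; each statement's English description precedes it below -/
import Mathlib

section
/- Let p be an odd prime and n a positive integer not divisible by p, and let K be the unramified extension of ℚ_p of degree n. Then for every x ∈ K*, the element ξ(x) = ω(x)^{−1} r(x)^{−1} x belongs to Σ_n; consequently every x ∈ K* admits a representation x = ω ξ r with ω ∈ μ_{q−1}, ξ ∈ Σ_n and r ∈ ℚ_p^{(1)}. -/
open scoped Classical
noncomputable section

/-- The group `1 + pℤ_p` of principal units of `ℚ_p`. -/
def PUnits1 (p : ℕ) [Fact (Nat.Prime p)] : Set ℚ_[p] :=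
  {u : ℚ_[p] | ‖u - 1‖ ≤ (p : ℝ)⁻¹}

/-- The multiplicative subgroup `ℚ_p^{(1)} = p^ℤ · (1 + pℤ_p)` of `ℚ_p^*`. -/
def Qp1 (p : ℕ) [Fact (Nat.Prime p)] : Set ℚ_[p] :=
  {z : ℚ_[p] | ∃ ν : ℤ, ∃ u ∈ PUnits1 p, z = (p : ℚ_[p]) ^ ν * u}

/-- `ℚ_p^{(+)} = ℚ_p^{(1)} ∪ {0}`. -/
def QpPlus (p : ℕ) [Fact (Nat.Prime p)] : Set ℚ_[p] := Qp1 p ∪ {0}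

/-- The ring of integers `O` of a normed field, i.e. the closed unit ball. -/
def ringO (K : Type) [NormedField K] : Set K := {x : K | ‖x‖ ≤ 1}

/-- The group `U₁ = 1 + pO` of principal units of `K`. -/
def U1 (p : ℕ) (K : Type) [NormedField K] : Set K :=
  {x : K | ∃ y ∈ ringO K, x = 1 + (p : K) * y}

/-- The group `μ_{q-1}` of `(q-1)`-st roots of unity of `K`. -/
def muRoots (q : ℕ) (K : Type) [NormedField K] : Set K := {x : K | x ^ (q - 1) = 1}

/-- `ω : K → K` is a Teichmüller-component map: every `x ∈ K*` is uniquely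
`x = p^ν · ω(x) · u` with `ω(x) ∈ μ_{q-1}` and `u ∈ U₁`. -/
def IsTeich (p q : ℕ) (K : Type) [NormedField K] (ω : K → K) : Prop :=
  ∀ x : K, x ≠ 0 →
    (ω x ∈ muRoots q K ∧ ∃ ν : ℤ, ∃ u ∈ U1 p K, x = (p : K) ^ ν * (ω x * u)) ∧
    ∀ (w : K) (ν : ℤ) (u : K), w ∈ muRoots q K → u ∈ U1 p K →
      x = (p : K) ^ ν * (w * u) → w = ω x

/-- The compact group `Σ_n = {y ∈ K* : ω(y) = 1, N(y) = 1}`. -/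
def SigmaN (p : ℕ) [Fact (Nat.Prime p)] (K : Type) [NormedField K] [Algebra ℚ_[p] K]
    (ω : K → K) : Set K :=
  {y : K | y ≠ 0 ∧ ω y = 1 ∧ Algebra.norm ℚ_[p] y = 1}

/-- `r : K* → ℚ_p^{(1)}`, `r(x) = (N(ω(x)⁻¹ x))^{1/n}`, the radial part of the
spherical coordinates (characterized by `r(x) ∈ ℚ_p^{(1)}` and `r(x)^n = N(ω(x)⁻¹ x)`,
which determines it uniquely since `p ∤ n`). -/
def IsRadial (p n : ℕ) [Fact (Nat.Prime p)] (K : Type) [NormedField K] [Algebra ℚ_[p] K]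
    (ω : K → K) (r : K → ℚ_[p]) : Prop :=
  ∀ x : K, x ≠ 0 → r x ∈ Qp1 p ∧ (r x) ^ n = Algebra.norm ℚ_[p] ((ω x)⁻¹ * x)

/-- `K` is the unramified extension of `ℚ_p` of degree `n`: it has degree `n`,
its norm is the normalized absolute value `‖x‖ = |N(x)|_p`, and its value group
is `q^ℤ`, `q = p^n` (i.e. the extension is unramified). -/
def IsUnramifiedDeg (p n : ℕ) [Fact (Nat.Prime p)] (K : Type) [NormedField K]
    [Algebra ℚ_[p] K] : Prop :=
  Module.finrank ℚ_[p] K = n ∧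
  (∀ x : K, ‖x‖ = ‖Algebra.norm ℚ_[p] x‖) ∧
  (∀ x : K, x ≠ 0 → ∃ m : ℤ, ‖x‖ = (p : ℝ) ^ ((n : ℤ) * m))

section UnramifiedExtension

variable {p n : ℕ} [Fact (Nat.Prime p)] {K : Type} [NormedField K] [Algebra ℚ_[p] K]

theorem IsUnramifiedDeg.norm_algebraMap (hK : IsUnramifiedDeg p n K) (a : ℚ_[p]) :
    ‖algebraMap ℚ_[p] K a‖ = ‖a‖ ^ n := by
  rw [hK.2.1, Algebra.norm_algebraMap, hK.1, norm_pow]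

theorem IsUnramifiedDeg.norm_natCast_self (hK : IsUnramifiedDeg p n K) :
    ‖(p : K)‖ = ((p : ℝ)⁻¹) ^ n := by
  rw [← map_natCast (algebraMap ℚ_[p] K) p, hK.norm_algebraMap, Padic.norm_p]

theorem IsUnramifiedDeg.isUltrametricDist (hK : IsUnramifiedDeg p n K) :
    IsUltrametricDist K := by
  refine IsUltrametricDist.isUltrametricDist_of_forall_norm_natCast_le_one fun m => ?_
  rw [← map_natCast (algebraMap ℚ_[p] K) m, hK.norm_algebraMap]
  exact pow_le_one₀ (norm_nonneg _) (by simpa using Padic.norm_int_le_one (p := p) m)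

theorem mem_U1_iff_norm_sub_one_le {p : ℕ} {K : Type} [NormedField K] (hp : (p : K) ≠ 0) {u : K} :
    u ∈ U1 p K ↔ ‖u - 1‖ ≤ ‖(p : K)‖ := by
  constructor
  · rintro ⟨y, hy, rfl⟩
    rw [add_sub_cancel_left, norm_mul]
    exact mul_le_of_le_one_right (norm_nonneg _) hy
  · intro h
    refine ⟨(u - 1) / p, ?_, by field_simp; ring⟩
    change ‖(u - 1) / p‖ ≤ 1
    rw [norm_div]
    exact div_le_one_of_le₀ h (norm_nonneg _)

theorem norm_eq_one_of_norm_sub_one_lt_one {F : Type*} [NormedField F] [IsUltrametricDist F]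
    {u : F} (h : ‖u - 1‖ < 1) : ‖u‖ = 1 := by
  have := IsUltrametricDist.norm_add_eq_max_of_norm_ne_norm (x := u - 1) (y := 1)
    (by rw [norm_one]; exact h.ne)
  rwa [sub_add_cancel, norm_one, max_eq_right h.le] at this

theorem norm_eq_one_of_mem_PUnits1 {v : ℚ_[p]} (hv : v ∈ PUnits1 p) : ‖v‖ = 1 :=
  norm_eq_one_of_norm_sub_one_lt_one <| lt_of_le_of_lt hv <|
    inv_lt_one_of_one_lt₀ (by exact_mod_cast (Fact.out : p.Prime).one_lt)

theorem IsUnramifiedDeg.natCast_self_ne_zero (hK : IsUnramifiedDeg p n K) : (p : K) ≠ 0 := by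
  rw [← norm_ne_zero_iff, hK.norm_natCast_self]
  exact pow_ne_zero _ (inv_ne_zero (by exact_mod_cast (Fact.out : p.Prime).ne_zero))

theorem IsUnramifiedDeg.norm_eq_one_of_mem_U1 (hn : 0 < n) (hK : IsUnramifiedDeg p n K)
    {u : K} (hu : u ∈ U1 p K) : ‖u‖ = 1 := by
  have := hK.isUltrametricDist
  refine norm_eq_one_of_norm_sub_one_lt_one
    (((mem_U1_iff_norm_sub_one_le hK.natCast_self_ne_zero).1 hu).trans_lt ?_)
  rw [hK.norm_natCast_self]
  exact pow_lt_one₀ (by positivity)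
    (inv_lt_one_of_one_lt₀ (by exact_mod_cast (Fact.out : p.Prime).one_lt)) hn.ne'

theorem IsUnramifiedDeg.algebraMap_inv_mul_mem_U1 (hK : IsUnramifiedDeg p n K)
    {v : ℚ_[p]} (hv : v ∈ PUnits1 p) {u : K} (hu : u ∈ U1 p K) :
    (algebraMap ℚ_[p] K v)⁻¹ * u ∈ U1 p K := by
  have := hK.isUltrametricDist
  have hp := hK.natCast_self_ne_zero
  have hv1 : ‖algebraMap ℚ_[p] K v‖ = 1 := by
    rw [hK.norm_algebraMap, norm_eq_one_of_mem_PUnits1 hv, one_pow]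
  have hv0 : algebraMap ℚ_[p] K v ≠ 0 := by
    rw [← norm_ne_zero_iff, hv1]; exact one_ne_zero
  have hvp : ‖algebraMap ℚ_[p] K v - 1‖ ≤ ‖(p : K)‖ := by
    rw [hK.norm_natCast_self, ← map_one (algebraMap ℚ_[p] K), ← map_sub, hK.norm_algebraMap]
    exact pow_le_pow_left₀ (norm_nonneg _) hv n
  rw [mem_U1_iff_norm_sub_one_le hp] at hu ⊢
  have h : (algebraMap ℚ_[p] K v)⁻¹ * u - 1 =
      (algebraMap ℚ_[p] K v)⁻¹ * ((u - 1) - (algebraMap ℚ_[p] K v - 1)) := by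
    field_simp; ring
  rw [h, norm_mul, norm_inv, hv1, inv_one, one_mul]
  rw [sub_eq_add_neg]
  refine (IsUltrametricDist.norm_add_le_max _ _).trans (max_le hu ?_)
  rwa [norm_neg]

end UnramifiedExtension

/-- For every `x ∈ K*`, `ξ(x) = ω(x)⁻¹ r(x)⁻¹ x ∈ Σ_n`; consequently every
`x ∈ K*` admits a representation `x = ω ξ r` with `ω ∈ μ_{q-1}`, `ξ ∈ Σ_n`, `r ∈ ℚ_p^{(1)}`. -/
theorem spherical_coordinates_exist
    (p n q : ℕ) [Fact (Nat.Prime p)] (hp2 : p ≠ 2) (hn : 0 < n) (hpn : ¬ p ∣ n)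
    (hq : q = p ^ n)
    (K : Type) [NormedField K] [Algebra ℚ_[p] K] [FiniteDimensional ℚ_[p] K]
    (hK : IsUnramifiedDeg p n K)
    (ω : K → K) (hω : IsTeich p q K ω)
    (r : K → ℚ_[p]) (hr : IsRadial p n K ω r) :
    ∀ x : K, x ≠ 0 →
      (ω x)⁻¹ * (algebraMap ℚ_[p] K (r x))⁻¹ * x ∈ SigmaN p K ω ∧
      ∃ w ∈ muRoots q K, ∃ ξ ∈ SigmaN p K ω, ∃ ρ ∈ Qp1 p,
        x = w * ξ * algebraMap ℚ_[p] K ρ := by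
  intro x hx
  obtain ⟨⟨hωμ, ν, u, hu, hxu⟩, -⟩ := hω x hx
  obtain ⟨⟨μ, v, hv, hrv⟩, hrn⟩ := hr x hx
  have hp := hK.natCast_self_ne_zero
  have hω0 : ω x ≠ 0 := by
    intro h
    apply hx
    rw [hxu, h, zero_mul, mul_zero]
  have hωx : (ω x)⁻¹ * x = (p : K) ^ ν * u := by
    nth_rewrite 2 [hxu]
    field_simp
  have hr0 : r x ≠ 0 := by
    intro h
    rw [h, zero_pow hn.ne', eq_comm, Algebra.norm_eq_zero_iff] at hrn
    exact mul_ne_zero (inv_ne_zero hω0) hx hrn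
  have hrK : algebraMap ℚ_[p] K (r x) ≠ 0 := by simpa using hr0
  have hμν : μ = ν := by
    have h := congrArg norm hrn
    have hp1 : (1 : ℝ) < p := by exact_mod_cast (Fact.out : p.Prime).one_lt
    rw [← hK.2.1, hωx, norm_mul, norm_zpow, hK.norm_eq_one_of_mem_U1 hn hu,
      hK.norm_natCast_self, mul_one, norm_pow, hrv, norm_mul, norm_zpow,
      norm_eq_one_of_mem_PUnits1 hv, Padic.norm_p, mul_one, ← zpow_natCast,
      ← zpow_natCast, zpow_comm, zpow_natCast] at h
    have h1 := pow_lt_one₀ (by positivity) (inv_lt_one_of_one_lt₀ hp1) hn.ne'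
    exact zpow_right_injective₀ (by positivity) h1.ne h
  set ξ := (ω x)⁻¹ * (algebraMap ℚ_[p] K (r x))⁻¹ * x with hξ
  have hξu : ξ = (algebraMap ℚ_[p] K v)⁻¹ * u := by
    rw [hξ, mul_right_comm, hωx, hrv, hμν, map_mul, map_zpow₀, map_natCast, mul_inv]
    field_simp
  have hξ0 : ξ ≠ 0 := mul_ne_zero (mul_ne_zero (inv_ne_zero hω0) (inv_ne_zero hrK)) hx
  have hξmem : ξ ∈ SigmaN p K ω := by
    refine ⟨hξ0, ?_, ?_⟩
    · refine ((hω ξ hξ0).2 1 0 ξ (one_pow _) ?_ (by simp)).symm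
      rw [hξu]
      exact hK.algebraMap_inv_mul_mem_U1 hv hu
    · rw [hξ, mul_right_comm, map_mul, ← hrn, ← map_inv₀, Algebra.norm_algebraMap, hK.1,
        ← mul_pow, mul_inv_cancel₀ hr0, one_pow]
  refine ⟨hξmem, ω x, hωμ, ξ, hξmem, r x, (hr x hx).1, ?_⟩
  rw [hξ]
  field_simp
end
end

section
/- Let p be an odd prime and n a positive integer not divisible by p, and let K be the unramified extension of ℚ_p of degree n. The representation of an element x ∈ K* as a product x = ω ξ r with ω ∈ μ_{q−1}, ξ ∈ Σ_n and r ∈ ℚ_p^{(1)} is unique: if ω ξ r = ω₁ ξ₁ r₁ with ω, ω₁ ∈ μ_{q−1}, ξ, ξ₁ ∈ Σ_n, r, r₁ ∈ ℚ_p^{(1)}, then ω = ω₁, ξ = ξ₁ and r = r₁. -/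
open scoped Classical
noncomputable section

section Helpers

theorem U1_mul_mem {p : ℕ} {K : Type} [NormedField K] [IsUltrametricDist K]
    (hp : ‖(p : K)‖ ≤ 1) {u v : K}
    (hu : u ∈ U1 p K) (hv : v ∈ U1 p K) : u * v ∈ U1 p K := by
  obtain ⟨y, hy, rfl⟩ := hu
  obtain ⟨z, hz, rfl⟩ := hv
  have hy' : ‖y‖ ≤ 1 := hy
  have hz' : ‖z‖ ≤ 1 := hz
  refine ⟨y + z + p * (y * z), ?_, by ring⟩
  have hyz : ‖(p : K) * (y * z)‖ ≤ 1 := by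
    rw [norm_mul, norm_mul]
    exact mul_le_one₀ hp (by positivity) (mul_le_one₀ hy' (by positivity) hz')
  exact (IsUltrametricDist.norm_add_le_max _ _).trans
    (max_le ((IsUltrametricDist.norm_add_le_max _ _).trans (max_le hy' hz')) hyz)

theorem muRoots.ne_zero {q : ℕ} {K : Type} [NormedField K] (hq : 1 < q) {w : K}
    (hw : w ∈ muRoots q K) : w ≠ 0 := by
  rintro rfl
  have h : (0 : K) ^ (q - 1) = 1 := hw
  rw [zero_pow (by lia)] at h
  exact zero_ne_one h

variable {p : ℕ} [Fact (Nat.Prime p)] {K : Type} [NormedField K]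

theorem norm_algebraMap_of_norm_eq [Algebra ℚ_[p] K]
    (h : ∀ x : K, ‖x‖ = ‖Algebra.norm ℚ_[p] x‖) (z : ℚ_[p]) :
    ‖algebraMap ℚ_[p] K z‖ = ‖z‖ ^ Module.finrank ℚ_[p] K := by
  rw [h, Algebra.norm_algebraMap, norm_pow]

theorem norm_natCast_le_one_of_norm_eq [Algebra ℚ_[p] K]
    (h : ∀ x : K, ‖x‖ = ‖Algebra.norm ℚ_[p] x‖) (m : ℕ) : ‖(m : K)‖ ≤ 1 := by
  rw [← map_natCast (algebraMap ℚ_[p] K) m, norm_algebraMap_of_norm_eq h]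
  exact pow_le_one₀ (norm_nonneg _) (by simpa using Padic.norm_int_le_one (p := p) m)

theorem PUnits1.exists_eq_one_add {v : ℚ_[p]} (hv : v ∈ PUnits1 p) :
    ∃ y : ℤ_[p], v = 1 + p * (y : ℚ_[p]) := by
  have hp0 : (p : ℚ_[p]) ≠ 0 := Nat.cast_ne_zero.2 (Fact.out : p.Prime).ne_zero
  have hpos : (0 : ℝ) < p := Nat.cast_pos.2 (Fact.out : p.Prime).pos
  have hv' : ‖v - 1‖ ≤ (p : ℝ)⁻¹ := hv
  refine ⟨⟨(v - 1) / p, ?_⟩, ?_⟩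
  · rw [norm_div, Padic.norm_p, div_le_one (inv_pos.2 hpos)]
    exact hv'
  · change v = 1 + p * ((v - 1) / p)
    field_simp
    ring

theorem PUnits1.algebraMap_mem_U1 [Algebra ℚ_[p] K]
    (h : ∀ x : K, ‖x‖ = ‖Algebra.norm ℚ_[p] x‖) {v : ℚ_[p]} (hv : v ∈ PUnits1 p) :
    algebraMap ℚ_[p] K v ∈ U1 p K := by
  obtain ⟨y, rfl⟩ := PUnits1.exists_eq_one_add hv
  refine ⟨algebraMap ℚ_[p] K y, ?_, by simp⟩
  change ‖algebraMap ℚ_[p] K y‖ ≤ 1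
  rw [norm_algebraMap_of_norm_eq h]
  exact pow_le_one₀ (norm_nonneg _) y.norm_le_one

theorem PUnits1.pow_left_injective {n : ℕ} (hpn : ¬ p ∣ n) {u v : ℚ_[p]}
    (hu : u ∈ PUnits1 p) (hv : v ∈ PUnits1 p) (h : u ^ n = v ^ n) : u = v := by
  obtain ⟨y, rfl⟩ := PUnits1.exists_eq_one_add hu
  obtain ⟨z, rfl⟩ := PUnits1.exists_eq_one_add hv
  have h' : (1 + p * y : ℤ_[p]) ^ n = (1 + p * z) ^ n := by
    apply Subtype.coe_injective
    push_cast
    exact h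
  have hg := geom_sum₂_mul (1 + p * y : ℤ_[p]) (1 + p * z) n
  rw [h', sub_self] at hg
  rcases mul_eq_zero.1 hg with hs | hs
  · have := congrArg (PadicInt.toZMod (p := p)) hs
    simp [ZMod.natCast_eq_zero_iff] at this
    exact absurd this hpn
  · have := congrArg (fun t : ℤ_[p] => (t : ℚ_[p])) (sub_eq_zero.1 hs)
    push_cast at this
    exact this

theorem PUnits1.norm_eq_one {u : ℚ_[p]} (hu : u ∈ PUnits1 p) : ‖u‖ = 1 := by
  have h1 : ‖u - 1‖ < 1 := lt_of_le_of_lt hu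
    (inv_lt_one_of_one_lt₀ (Nat.one_lt_cast.2 (Fact.out : p.Prime).one_lt))
  have h2 := Padic.add_eq_max_of_ne (p := p) (q := u - 1) (r := 1)
    (by rw [norm_one]; exact h1.ne)
  rw [sub_add_cancel, norm_one, max_eq_right h1.le] at h2
  exact h2

theorem Qp1.pow_left_injective {n : ℕ} (hn : 0 < n) (hpn : ¬ p ∣ n) {ρ ρ₁ : ℚ_[p]}
    (hρ : ρ ∈ Qp1 p) (hρ₁ : ρ₁ ∈ Qp1 p) (h : ρ ^ n = ρ₁ ^ n) : ρ = ρ₁ := by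
  obtain ⟨k, v, hv, rfl⟩ := hρ
  obtain ⟨l, v₁, hv₁, rfl⟩ := hρ₁
  have hp0 : (p : ℚ_[p]) ≠ 0 := Nat.cast_ne_zero.2 (Fact.out : p.Prime).ne_zero
  have hkl : k = l := by
    have hnorm := congrArg norm h
    rw [norm_pow, norm_pow, pow_left_inj₀ (norm_nonneg _) (norm_nonneg _) hn.ne',
      norm_mul, norm_mul, PUnits1.norm_eq_one hv, PUnits1.norm_eq_one hv₁, mul_one, mul_one,
      Padic.norm_p_zpow, Padic.norm_p_zpow] at hnorm
    have hp1 : (1 : ℝ) < p := Nat.one_lt_cast.2 (Fact.out : p.Prime).one_lt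
    exact neg_injective (zpow_right_injective₀ (zero_lt_one.trans hp1) hp1.ne' hnorm)
  subst hkl
  rw [mul_pow, mul_pow] at h
  rw [PUnits1.pow_left_injective hpn hv hv₁
    (mul_left_cancel₀ (pow_ne_zero _ (zpow_ne_zero _ hp0)) h)]

theorem Qp1.ne_zero {ρ : ℚ_[p]} (hρ : ρ ∈ Qp1 p) : ρ ≠ 0 := by
  obtain ⟨k, v, hv, rfl⟩ := hρ
  refine mul_ne_zero (zpow_ne_zero _ (Nat.cast_ne_zero.2 (Fact.out : p.Prime).ne_zero)) ?_
  rw [← norm_ne_zero_iff, PUnits1.norm_eq_one hv]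
  exact one_ne_zero

theorem IsTeich.eq_of_spherical [Algebra ℚ_[p] K] {q : ℕ} {ω : K → K} (hω : IsTeich p q K ω)
    (h : ∀ x : K, ‖x‖ = ‖Algebra.norm ℚ_[p] x‖) (hq : 1 < q) {w ξ : K} {ρ : ℚ_[p]}
    (hw : w ∈ muRoots q K) (hξ : ξ ∈ SigmaN p K ω) (hρ : ρ ∈ Qp1 p) :
    w = ω (w * ξ * algebraMap ℚ_[p] K ρ) := by
  have : CharZero K := charZero_of_injective_algebraMap (algebraMap ℚ_[p] K).injective
  have : IsUltrametricDist K := IsUltrametricDist.isUltrametricDist_of_forall_norm_natCast_le_one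
    (norm_natCast_le_one_of_norm_eq h)
  have hp0 : (p : K) ≠ 0 := Nat.cast_ne_zero.2 (Fact.out : p.Prime).ne_zero
  have hρ0 := Qp1.ne_zero hρ
  obtain ⟨hξ0, hωξ, -⟩ := hξ
  obtain ⟨ν, u, hu, hξu⟩ := (hω ξ hξ0).1.2
  obtain ⟨k, v, hv, rfl⟩ := hρ
  refine (hω _ (mul_ne_zero (mul_ne_zero (muRoots.ne_zero hq hw) hξ0)
    ((map_ne_zero _).2 hρ0))).2 w (ν + k) (u * algebraMap ℚ_[p] K v) hw
    (U1_mul_mem (norm_natCast_le_one_of_norm_eq h p) hu (PUnits1.algebraMap_mem_U1 h hv)) ?_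
  rw [hωξ, one_mul] at hξu
  rw [hξu, zpow_add₀ hp0, map_mul, map_zpow₀, map_natCast]
  ring

end Helpers

/-- Uniqueness of the spherical-coordinate representation `x = ω ξ r`. -/
theorem spherical_coordinates_unique
    (p n q : ℕ) [Fact (Nat.Prime p)] (hp2 : p ≠ 2) (hn : 0 < n) (hpn : ¬ p ∣ n)
    (hq : q = p ^ n)
    (K : Type) [NormedField K] [Algebra ℚ_[p] K] [FiniteDimensional ℚ_[p] K]
    (hK : IsUnramifiedDeg p n K)
    (ω : K → K) (hω : IsTeich p q K ω) :
    ∀ w w₁ ξ ξ₁ : K, ∀ ρ ρ₁ : ℚ_[p],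
      w ∈ muRoots q K → w₁ ∈ muRoots q K →
      ξ ∈ SigmaN p K ω → ξ₁ ∈ SigmaN p K ω →
      ρ ∈ Qp1 p → ρ₁ ∈ Qp1 p →
      w * ξ * algebraMap ℚ_[p] K ρ = w₁ * ξ₁ * algebraMap ℚ_[p] K ρ₁ →
      w = w₁ ∧ ξ = ξ₁ ∧ ρ = ρ₁ := by
  intro w w₁ ξ ξ₁ ρ ρ₁ hw hw₁ hξ hξ₁ hρ hρ₁ h
  obtain ⟨hfin, hnorm, -⟩ := hK
  have hq1 : 1 < q := hq ▸ Nat.one_lt_pow hn.ne' (Fact.out : p.Prime).one_lt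
  have hww : w = w₁ := by
    rw [hω.eq_of_spherical hnorm hq1 hw hξ hρ, h, ← hω.eq_of_spherical hnorm hq1 hw₁ hξ₁ hρ₁]
  subst hww
  rw [mul_assoc, mul_assoc] at h
  replace h := mul_left_cancel₀ (muRoots.ne_zero hq1 hw) h
  have hN := congrArg (Algebra.norm ℚ_[p]) h
  rw [map_mul, map_mul, hξ.2.2, hξ₁.2.2, one_mul, one_mul, Algebra.norm_algebraMap,
    Algebra.norm_algebraMap, hfin] at hN
  have hρρ : ρ = ρ₁ := Qp1.pow_left_injective hn hpn hρ hρ₁ hN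
  subst hρρ
  exact ⟨rfl, mul_right_cancel₀ ((map_ne_zero _).2 (Qp1.ne_zero hρ)) h, rfl⟩
end
end

section
/- Let p be an odd prime, n a positive integer not divisible by p, and q = p^n. If t₁, …, t_{n−1}, 1 form a basis of the finite field 𝔽_q over 𝔽_p, then the elements t₁ − t₁^p, t₂ − t₂^p, …, t_{n−1} − t_{n−1}^p, 1 also form a basis of 𝔽_q over 𝔽_p. -/
open scoped Classical
noncomputable section

/-- The `𝔽_p`-linear map `x ↦ x - x ^ p` on a field of characteristic `p`. -/
def subFrobenius (p : ℕ) [Fact p.Prime] (L : Type*) [Field L] [Algebra (ZMod p) L] :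
    L →ₗ[ZMod p] L :=
  LinearMap.id - (FiniteField.frobeniusAlgHom (ZMod p) L).toLinearMap

theorem subFrobenius_apply {p : ℕ} [Fact p.Prime] {L : Type*} [Field L] [Algebra (ZMod p) L]
    (x : L) : subFrobenius p L x = x - x ^ p := by
  simp [subFrobenius]

theorem mem_span_one_of_subFrobenius_eq_zero {p : ℕ} [Fact p.Prime] {L : Type*} [Field L]
    [Algebra (ZMod p) L] {x : L} (hx : subFrobenius p L x = 0) :
    x ∈ Submodule.span (ZMod p) {(1 : L)} := by
  have := charP_of_injective_algebraMap (algebraMap (ZMod p) L).injective p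
  rw [subFrobenius_apply, sub_eq_zero] at hx
  obtain ⟨k, hk⟩ := (mem_bot_iff_intCast p L).1
    ((Subfield.mem_bot_iff_pow_eq_self L p).2 hx.symm)
  exact Submodule.mem_span_singleton.2 ⟨k, by rw [Algebra.smul_def]; simp [hk]⟩

theorem trace_subFrobenius {p : ℕ} [Fact p.Prime] {L : Type*} [Field L] [Finite L]
    [Algebra (ZMod p) L] (x : L) : Algebra.trace (ZMod p) L (subFrobenius p L x) = 0 := by
  have h := Algebra.trace_eq_of_algEquiv
    (FiniteField.frobeniusAlgEquivOfAlgebraic (ZMod p) L) x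
  simp only [FiniteField.coe_frobeniusAlgEquivOfAlgebraic, ZMod.card] at h
  rw [subFrobenius_apply, map_sub, h, sub_self]

/-- If `t₁, …, t_{n-1}, 1` is a basis of `𝔽_q` over `𝔽_p` (`q = p^n`,
`p` an odd prime not dividing `n`), then `t₁ - t₁^p, …, t_{n-1} - t_{n-1}^p, 1`
is also a basis of `𝔽_q` over `𝔽_p`. -/
theorem frobenius_difference_basis
    (p n : ℕ) [Fact (Nat.Prime p)] (hp2 : p ≠ 2) (hn : 0 < n) (hpn : ¬ p ∣ n)
    (t : Fin (n - 1) → GaloisField p n)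
    (hind : LinearIndependent (ZMod p) (Fin.snoc t (1 : GaloisField p n)))
    (hspan : Submodule.span (ZMod p)
        (Set.range (Fin.snoc t (1 : GaloisField p n))) = ⊤) :
    LinearIndependent (ZMod p)
        (Fin.snoc (fun i => t i - (t i) ^ p) (1 : GaloisField p n)) ∧
    Submodule.span (ZMod p)
        (Set.range (Fin.snoc (fun i => t i - (t i) ^ p) (1 : GaloisField p n))) = ⊤ := by
  have hrank : Module.finrank (ZMod p) (GaloisField p n) = n := GaloisField.finrank p hn.ne'
  have hcomp : (fun i => t i - t i ^ p) = subFrobenius p (GaloisField p n) ∘ t :=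
    funext fun i => (subFrobenius_apply (t i)).symm
  obtain ⟨ht, h1⟩ := linearIndependent_finSnoc.1 hind
  have hli : LinearIndependent (ZMod p)
      (Fin.snoc (fun i => t i - (t i) ^ p) (1 : GaloisField p n)) := by
    rw [hcomp]
    refine linearIndependent_finSnoc.2 ⟨ht.map ?_, fun hmem => ?_⟩
    · rw [Submodule.disjoint_def]
      intro x hxt hx
      obtain ⟨c, rfl⟩ := Submodule.mem_span_singleton.1 (mem_span_one_of_subFrobenius_eq_zero hx)
      by_contra hc
      exact h1 ((Submodule.smul_mem_iff _ (left_ne_zero_of_smul hc)).1 hxt)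
    · have hle : Submodule.span (ZMod p) (Set.range (subFrobenius p (GaloisField p n) ∘ t)) ≤
          LinearMap.ker (Algebra.trace (ZMod p) (GaloisField p n)) := by
        rw [Submodule.span_le]
        rintro _ ⟨i, rfl⟩
        exact trace_subFrobenius (t i)
      have htr : Algebra.trace (ZMod p) (GaloisField p n) 1 = 0 := hle hmem
      rw [← map_one (algebraMap (ZMod p) (GaloisField p n)), Algebra.trace_algebraMap, hrank,
        nsmul_one, ZMod.natCast_eq_zero_iff] at htr
      exact hpn htr
  exact ⟨hli, hli.span_eq_top_of_card_eq_finrank' (by simp [hrank]; omega)⟩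
end
end

section
/- Let p be a prime, n a positive integer, and q = p^n. If t₁, …, t_{n−1}, 1 form a basis of the finite field 𝔽_q over 𝔽_p, then the n−1 elements t₁ − t₁^p, t₂ − t₂^p, …, t_{n−1} − t_{n−1}^p are linearly independent over 𝔽_p. -/
open scoped Classical
noncomputable section

/-- The kernel of `x ↦ x - x ^ p` on a field of characteristic `p` is the prime field. -/
theorem ker_id_sub_frobeniusAlgHom (p : ℕ) [Fact p.Prime] (K : Type*) [Field K]
    [Algebra (ZMod p) K] :
    LinearMap.ker (LinearMap.id - (FiniteField.frobeniusAlgHom (ZMod p) K).toLinearMap) =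
      Submodule.span (ZMod p) {(1 : K)} := by
  have : CharP K p := charP_of_injective_algebraMap' (ZMod p) p
  ext x
  have hker : x ∈ LinearMap.ker
      (LinearMap.id - (FiniteField.frobeniusAlgHom (ZMod p) K).toLinearMap) ↔ x ^ p = x := by
    simp [sub_eq_zero, eq_comm]
  rw [hker, ← Subfield.mem_bot_iff_pow_eq_self, ← ZMod.fieldRange_castHom_eq_bot p,
    Submodule.mem_span_singleton]
  simp only [Algebra.smul_def, mul_one, RingHom.mem_fieldRange,
    Subsingleton.elim (algebraMap (ZMod p) K) (ZMod.castHom dvd_rfl K)]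

/-- If `t₁, …, t_{n-1}, 1` is a basis of `𝔽_q` over `𝔽_p` (`q = p^n`),
then the `n-1` elements `t₁ - t₁^p, …, t_{n-1} - t_{n-1}^p` are linearly
independent over `𝔽_p`. -/
theorem frobenius_difference_linearIndependent
    (p n : ℕ) [Fact (Nat.Prime p)] (hn : 0 < n)
    (t : Fin (n - 1) → GaloisField p n)
    (hind : LinearIndependent (ZMod p) (Fin.snoc t (1 : GaloisField p n)))
    (hspan : Submodule.span (ZMod p)
        (Set.range (Fin.snoc t (1 : GaloisField p n))) = ⊤) :
    LinearIndependent (ZMod p) (fun i : Fin (n - 1) => t i - (t i) ^ p) := by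
  obtain ⟨ht, hone⟩ := linearIndependent_finSnoc.mp hind
  have hdisj : Disjoint (Submodule.span (ZMod p) (Set.range t)) (LinearMap.ker
      (LinearMap.id - (FiniteField.frobeniusAlgHom (ZMod p) (GaloisField p n)).toLinearMap)) := by
    rw [ker_id_sub_frobeniusAlgHom]
    exact (Submodule.disjoint_span_singleton' one_ne_zero).mpr hone
  simpa [Function.comp_def] using ht.map hdisj
end
end

section
/- Let p be an odd prime, n a positive integer, ν ∈ ℤ, and s a complex number with Re s > −n. Then ∫_{{r ∈ ℚ_p^{(1)} : |r|_p ≤ p^ν}} |r|_p^{s+n−1} dr = p^{ν(s+n)−1}/(1 − p^{−s−n}), where dr is the additive Haar measure on ℚ_p normalized by ∫_{ℤ_p} dr = 1. -/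
open scoped Classical
open MeasureTheory
noncomputable section

namespace Padic

variable {p : ℕ} [Fact (Nat.Prime p)]

theorem mem_closedBall_iff_norm_mul_zpow_sub_le_inv (x c : ℚ_[p]) (m : ℤ) :
    x ∈ Metric.closedBall (c * (p : ℚ_[p]) ^ (-m)) ((p : ℝ) ^ (m - 1)) ↔
      ‖x * (p : ℚ_[p]) ^ m - c‖ ≤ (p : ℝ)⁻¹ := by
  have hp : (p : ℚ_[p]) ≠ 0 := mod_cast (Fact.out : p.Prime).ne_zero
  have hp0 : (0 : ℝ) < p := mod_cast (Fact.out : p.Prime).pos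
  have h : x * (p : ℚ_[p]) ^ m - c = (x - c * (p : ℚ_[p]) ^ (-m)) * (p : ℚ_[p]) ^ m := by
    rw [sub_mul, mul_assoc, ← zpow_add₀ hp]; simp
  rw [mem_closedBall_iff_norm, h, norm_mul, norm_p_zpow, zpow_neg (p : ℝ), ← div_eq_mul_inv,
    div_le_iff₀ (zpow_pos hp0 m), zpow_sub_one₀ hp0.ne', mul_comm (p : ℝ)⁻¹]

theorem norm_lt_one_iff_norm_le_inv (x : ℚ_[p]) : ‖x‖ < 1 ↔ ‖x‖ ≤ (p : ℝ)⁻¹ := by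
  simpa using norm_lt_pow_iff_norm_le_pow_sub_one x 0

theorem closedBall_zero_zpow_eq_biUnion (m : ℤ) :
    Metric.closedBall (0 : ℚ_[p]) ((p : ℝ) ^ m) =
      ⋃ i ∈ Finset.range p,
        Metric.closedBall ((i : ℚ_[p]) * (p : ℚ_[p]) ^ (-m)) ((p : ℝ) ^ (m - 1)) := by
  have hp0 : (0 : ℝ) < p := mod_cast (Fact.out : p.Prime).pos
  ext x
  have h : x ∈ Metric.closedBall (0 : ℚ_[p]) ((p : ℝ) ^ m) ↔ ‖x * (p : ℚ_[p]) ^ m‖ ≤ 1 := by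
    rw [mem_closedBall_zero_iff, norm_mul, norm_p_zpow, zpow_neg, ← div_eq_mul_inv,
      div_le_one (zpow_pos hp0 m)]
  have h' (i : ℕ) := (mem_closedBall_iff_norm_mul_zpow_sub_le_inv x i m).trans
    (norm_lt_one_iff_norm_le_inv _).symm
  simp only [Set.mem_iUnion, h, h', Finset.mem_range, exists_prop]
  constructor
  · intro hx
    let y : ℤ_[p] := ⟨x * (p : ℚ_[p]) ^ m, hx⟩
    refine ⟨y.zmodRepr, y.zmodRepr_lt_p, ?_⟩
    have hy := y.norm_sub_zmodRepr_lt_one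
    rwa [PadicInt.norm_def, PadicInt.coe_sub, PadicInt.coe_natCast] at hy
  · rintro ⟨i, -, hi⟩
    have h1 : ‖(i : ℚ_[p])‖ ≤ 1 := mod_cast norm_int_le_one (p := p) (i : ℤ)
    calc ‖x * (p : ℚ_[p]) ^ m‖ = ‖(x * (p : ℚ_[p]) ^ m - i) + i‖ := by rw [sub_add_cancel]
      _ ≤ max _ _ := nonarchimedean _ _
      _ ≤ 1 := max_le hi.le h1

theorem pairwiseDisjoint_closedBall_natCast_mul_zpow (m : ℤ) :
    (Finset.range p : Set ℕ).PairwiseDisjoint fun i : ℕ ↦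
      Metric.closedBall ((i : ℚ_[p]) * (p : ℚ_[p]) ^ (-m)) ((p : ℝ) ^ (m - 1)) := by
  intro i hi j hj hij
  refine Set.disjoint_left.2 fun x hx hx' ↦ hij ?_
  rw [mem_closedBall_iff_norm_mul_zpow_sub_le_inv, ← norm_lt_one_iff_norm_le_inv] at hx hx'
  rw [norm_sub_rev] at hx
  have h : ‖(((i : ℤ) - j : ℤ) : ℚ_[p])‖ < 1 := by
    calc ‖(((i : ℤ) - j : ℤ) : ℚ_[p])‖
        = ‖((i : ℚ_[p]) - x * (p : ℚ_[p]) ^ m) + (x * (p : ℚ_[p]) ^ m - j)‖ := by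
          push_cast; rw [sub_add_sub_cancel]
      _ ≤ max _ _ := nonarchimedean _ _
      _ < 1 := max_lt hx hx'
  rw [norm_intCast_lt_one_iff] at h
  simp only [Finset.coe_range, Set.mem_Iio] at hi hj
  have := Int.eq_zero_of_abs_lt_dvd h (by rw [abs_lt]; omega)
  omega

variable [MeasurableSpace ℚ_[p]] [BorelSpace ℚ_[p]]
  (μ : Measure ℚ_[p]) [μ.IsAddHaarMeasure]

theorem measureReal_closedBall_zero_zpow_eq_mul (m : ℤ) :
    μ.real (Metric.closedBall 0 ((p : ℝ) ^ m)) =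
      p * μ.real (Metric.closedBall 0 ((p : ℝ) ^ (m - 1))) := by
  rw [closedBall_zero_zpow_eq_biUnion, measureReal_biUnion_finset
    (pairwiseDisjoint_closedBall_natCast_mul_zpow m)
    (fun _ _ ↦ measurableSet_closedBall) (fun _ _ ↦ measure_closedBall_lt_top.ne)]
  simp [Measure.addHaar_real_closedBall_center]

theorem measureReal_closedBall_zpow (hμ : μ {z : ℚ_[p] | ‖z‖ ≤ 1} = 1) (x : ℚ_[p]) (m : ℤ) :
    μ.real (Metric.closedBall x ((p : ℝ) ^ m)) = (p : ℝ) ^ m := by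
  have hp0 : (p : ℝ) ≠ 0 := mod_cast (Fact.out : p.Prime).ne_zero
  rw [Measure.addHaar_real_closedBall_center]
  induction m with
  | zero =>
    have : Metric.closedBall (0 : ℚ_[p]) 1 = {z | ‖z‖ ≤ 1} := by ext; simp
    simp [this, measureReal_def, hμ]
  | succ k ih =>
    rw [measureReal_closedBall_zero_zpow_eq_mul, add_sub_cancel_right, ih, zpow_add_one₀ hp0,
      mul_comm]
  | pred k ih =>
    rw [measureReal_closedBall_zero_zpow_eq_mul] at ih
    refine mul_left_cancel₀ hp0 (ih.trans ?_)
    rw [zpow_sub_one₀ hp0, mul_comm (_ ^ _), mul_inv_cancel_left₀ hp0]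

end Padic

section Shells

variable {p : ℕ} [Fact (Nat.Prime p)]

theorem norm_eq_zpow_of_mem_closedBall {m : ℤ} {x : ℚ_[p]}
    (hx : x ∈ Metric.closedBall ((p : ℚ_[p]) ^ (-m)) ((p : ℝ) ^ (m - 1))) :
    ‖x‖ = (p : ℝ) ^ m := by
  rw [mem_closedBall_iff_norm, ← Padic.norm_lt_pow_iff_norm_le_pow_sub_one] at hx
  have h : ‖(p : ℚ_[p]) ^ (-m)‖ = (p : ℝ) ^ m := by rw [Padic.norm_p_zpow, neg_neg]
  rw [← h] at hx ⊢
  exact Padic.norm_eq_of_norm_sub_lt_right hx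

theorem mem_Qp1_iff_exists_mem_closedBall {x : ℚ_[p]} :
    x ∈ Qp1 p ↔
      ∃ m : ℤ, x ∈ Metric.closedBall ((p : ℚ_[p]) ^ (-m)) ((p : ℝ) ^ (m - 1)) := by
  have hp : (p : ℚ_[p]) ≠ 0 := mod_cast (Fact.out : p.Prime).ne_zero
  have h (m : ℤ) := Padic.mem_closedBall_iff_norm_mul_zpow_sub_le_inv x 1 m
  simp only [one_mul] at h
  simp only [h]
  constructor
  · rintro ⟨k, u, hu, rfl⟩
    refine ⟨-k, ?_⟩
    rwa [mul_right_comm, ← zpow_add₀ hp, add_neg_cancel, zpow_zero, one_mul]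
  · rintro ⟨m, hm⟩
    refine ⟨-m, _, hm, ?_⟩
    rw [mul_left_comm, ← zpow_add₀ hp, neg_add_cancel, zpow_zero, mul_one]

theorem Qp1_inter_norm_le_eq_iUnion (ν : ℤ) :
    {r ∈ Qp1 p | ‖r‖ ≤ (p : ℝ) ^ ν} =
      ⋃ k : ℕ, Metric.closedBall ((p : ℚ_[p]) ^ (-(ν - k))) ((p : ℝ) ^ (ν - k - 1)) := by
  have hp1 : (1 : ℝ) < p := mod_cast (Fact.out : p.Prime).one_lt
  ext x
  simp only [Set.mem_ofPred_eq, mem_Qp1_iff_exists_mem_closedBall, Set.mem_iUnion]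
  constructor
  · rintro ⟨⟨m, hm⟩, hx⟩
    rw [norm_eq_zpow_of_mem_closedBall hm, zpow_le_zpow_iff_right₀ hp1] at hx
    refine ⟨(ν - m).toNat, ?_⟩
    have : ν - ((ν - m).toNat : ℤ) = m := by omega
    rwa [this]
  · rintro ⟨k, hk⟩
    refine ⟨⟨_, hk⟩, ?_⟩
    rw [norm_eq_zpow_of_mem_closedBall hk, zpow_le_zpow_iff_right₀ hp1]
    omega

theorem pairwise_disjoint_closedBall_zpow (ν : ℤ) :
    Pairwise (Function.onFun Disjoint fun k : ℕ ↦
      Metric.closedBall ((p : ℚ_[p]) ^ (-(ν - k))) ((p : ℝ) ^ (ν - k - 1))) := by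
  intro k l hkl
  refine Set.disjoint_left.2 fun x hx hx' ↦ hkl ?_
  have h := (norm_eq_zpow_of_mem_closedBall hx).symm.trans (norm_eq_zpow_of_mem_closedBall hx')
  rw [zpow_right_inj₀ (mod_cast (Fact.out : p.Prime).pos)
    (mod_cast (Fact.out : p.Prime).ne_one)] at h
  omega

theorem Complex.ofReal_zpow_cpow {x : ℝ} (hx : 0 < x) (m : ℤ) (z : ℂ) :
    ((x ^ m : ℝ) : ℂ) ^ z = (x : ℂ) ^ ((m : ℂ) * z) := by
  have hx' : (x : ℂ) ≠ 0 := mod_cast hx.ne'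
  rw [cpow_def_of_ne_zero (mod_cast (zpow_pos hx m).ne'), cpow_def_of_ne_zero hx',
    ← ofReal_log (zpow_pos hx m).le, ← ofReal_log hx.le, Real.log_zpow]
  push_cast
  ring_nf

variable [MeasurableSpace ℚ_[p]] [BorelSpace ℚ_[p]]
  (μ : Measure ℚ_[p]) [μ.IsAddHaarMeasure]

theorem setIntegral_closedBall_norm {E : Type*} [NormedAddCommGroup E] [NormedSpace ℝ E]
    [CompleteSpace E] (hμ : μ {z : ℚ_[p] | ‖z‖ ≤ 1} = 1) (m : ℤ) (g : ℝ → E) :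
    ∫ r in Metric.closedBall ((p : ℚ_[p]) ^ (-m)) ((p : ℝ) ^ (m - 1)), g ‖r‖ ∂μ =
      (p : ℝ) ^ (m - 1) • g ((p : ℝ) ^ m) := by
  rw [setIntegral_congr_fun measurableSet_closedBall
    (g := fun _ ↦ g ((p : ℝ) ^ m)) fun x hx ↦ by
      simp only [norm_eq_zpow_of_mem_closedBall hx],
    setIntegral_const, Padic.measureReal_closedBall_zpow μ hμ]

end Shells

/-- For `Re s > -n`,
`∫_{r ∈ ℚ_p^{(1)}, |r|_p ≤ p^ν} |r|_p^{s+n-1} dr = p^{ν(s+n)-1} / (1 - p^{-s-n})`. -/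
theorem integral_norm_cpow_on_Qp1
    (p n : ℕ) [Fact (Nat.Prime p)] (hp2 : p ≠ 2) (hn : 0 < n)
    [MeasurableSpace ℚ_[p]] [BorelSpace ℚ_[p]]
    (μQ : Measure ℚ_[p]) [μQ.IsAddHaarMeasure] (hμQ : μQ {z : ℚ_[p] | ‖z‖ ≤ 1} = 1)
    (ν : ℤ) (s : ℂ) (hs : -(n : ℝ) < s.re) :
    ∫ r in {r ∈ Qp1 p | ‖r‖ ≤ (p : ℝ) ^ ν},
        ((‖r‖ : ℂ)) ^ (s + (n : ℂ) - 1) ∂μQ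
      = (p : ℂ) ^ ((ν : ℂ) * (s + (n : ℂ)) - 1) / (1 - (p : ℂ) ^ (-s - (n : ℂ))) := by
  set z : ℂ := s + n with hz
  have hp0 : (0 : ℝ) < p := mod_cast (Fact.out : p.Prime).pos
  have hpc : (p : ℂ) ≠ 0 := mod_cast (Fact.out : p.Prime).ne_zero
  have hp1 : (1 : ℝ) < p := mod_cast (Fact.out : p.Prime).one_lt
  have hzre : 0 < z.re := by simp [hz]; linarith
  set q : ℂ := (p : ℂ) ^ (-z) with hq
  have hq1 : ‖q‖ < 1 := by
    rw [hq, ← Complex.ofReal_natCast, Complex.norm_cpow_eq_rpow_re_of_pos hp0]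
    exact Real.rpow_lt_one_of_one_lt_of_neg hp1 (by simpa using hzre)
  have hterm (k : ℕ) : ((p : ℝ) ^ (ν - k - 1)) • (((p : ℝ) ^ (ν - k) : ℝ) : ℂ) ^ (z - 1) =
      (p : ℂ) ^ ((ν : ℂ) * z - 1) * q ^ k := by
    rw [Complex.ofReal_zpow_cpow hp0, Complex.real_smul, Complex.ofReal_zpow,
      Complex.ofReal_natCast, ← Complex.cpow_intCast, ← Complex.cpow_add _ _ hpc, hq,
      ← Complex.cpow_nat_mul, ← Complex.cpow_add _ _ hpc]
    congr 1
    push_cast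
    ring
  have hconst (k : ℕ) := setIntegral_closedBall_norm μQ hμQ (ν - k) fun t ↦ (t : ℂ) ^ (z - 1)
  have hnorm (k : ℕ) :=
    setIntegral_closedBall_norm μQ hμQ (ν - k) fun t ↦ ‖(t : ℂ) ^ (z - 1)‖
  have hint : IntegrableOn (fun r : ℚ_[p] ↦ (‖r‖ : ℂ) ^ (z - 1))
      (⋃ k : ℕ, Metric.closedBall ((p : ℚ_[p]) ^ (-(ν - k))) ((p : ℝ) ^ (ν - k - 1))) μQ := by
    refine integrableOn_iUnion_of_summable_integral_norm (fun k ↦ ?_) ?_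
    · refine (integrableOn_const (C := (((p : ℝ) ^ (ν - k) : ℝ) : ℂ) ^ (z - 1))
        measure_closedBall_lt_top.ne).congr_fun (fun x hx ↦ ?_) measurableSet_closedBall
      simp only [norm_eq_zpow_of_mem_closedBall hx]
    · have h (k : ℕ) : (p : ℝ) ^ (ν - k - 1) • ‖(((p : ℝ) ^ (ν - k) : ℝ) : ℂ) ^ (z - 1)‖ =
          ‖(p : ℂ) ^ ((ν : ℂ) * z - 1)‖ * ‖q‖ ^ k := by
        rw [← norm_pow, ← norm_mul, ← hterm, norm_smul, Real.norm_of_nonneg (by positivity),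
          smul_eq_mul]
      simp only [hnorm, h]
      exact (summable_geometric_of_lt_one (norm_nonneg _) hq1).mul_left _
  have hsum := hasSum_integral_iUnion (fun _ ↦ measurableSet_closedBall)
    (pairwise_disjoint_closedBall_zpow ν) hint
  simp only [hconst, hterm] at hsum
  rw [Qp1_inter_norm_le_eq_iUnion, show -s - (n : ℂ) = -z by rw [hz]; ring, ← hq, div_eq_mul_inv]
  exact hsum.unique ((hasSum_geometric_of_norm_lt_one hq1).mul_left _)
end
end

section
/- Let p be an odd prime and n a positive integer not divisible by p, and let K be the unramified extension of ℚ_p of degree n. Every test function φ ∈ 𝒟(K) admits a decomposition into a finite sum φ(ω ξ r) = φ(0)Δ_l(r) + Σ_{m=1}^M φ(ω ξ r_m) Δ_l(r − r_m) for all ω ∈ μ_{q−1}, ξ ∈ Σ_n, r ∈ ℚ_p^{(+)}, where r_1, …, r_M are points of ℚ_p^{(1)} depending only on φ, and Δ_l is the indicator function of a ball {z ∈ ℚ_p : |z|_p ≤ p^l} for some l ∈ ℤ depending only on φ. -/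
open scoped Classical
noncomputable section

/-- A compactly supported locally constant function is uniformly locally constant. -/
theorem IsLocallyConstant.exists_forall_dist_lt_eq {X E : Type*} [PseudoMetricSpace X] [Zero E]
    {φ : X → E} (hφ : IsLocallyConstant φ) (hs : HasCompactSupport φ) :
    ∃ ε > 0, ∀ x y : X, dist x y < ε → φ x = φ y := by
  obtain ⟨ε, hε, h⟩ := lebesgue_number_lemma_of_metric (s := tsupport φ)
    (c := fun a : E => φ ⁻¹' {a}) hs (fun a => hφ {a})
    (fun x _ => Set.mem_iUnion.2 ⟨φ x, rfl⟩)
  have key : ∀ x y : X, x ∈ tsupport φ → dist x y < ε → φ x = φ y := by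
    intro x y hx hxy
    obtain ⟨a, ha⟩ := h x hx
    have h1 : φ x = a := ha (Metric.mem_ball_self hε)
    have h2 : φ y = a := ha (Metric.mem_ball'.2 hxy)
    rw [h1, h2]
  refine ⟨ε, hε, fun x y hxy => ?_⟩
  by_cases hx : x ∈ tsupport φ
  · exact key x y hx hxy
  by_cases hy : y ∈ tsupport φ
  · exact (key y x hy (by rwa [dist_comm])).symm
  rw [image_eq_zero_of_notMem_tsupport hx, image_eq_zero_of_notMem_tsupport hy]

/-- A bounded subset of a proper ultrametric space has a finite system of representatives for
the partition into closed balls of a given positive radius. -/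
theorem exists_fin_representatives_closedBall {X : Type*} [PseudoMetricSpace X] [ProperSpace X]
    [IsUltrametricDist X] {S : Set X} (hS : Bornology.IsBounded S) {δ : ℝ} (hδ : 0 < δ) :
    ∃ (M : ℕ) (c : Fin M → X), (∀ m, c m ∈ S) ∧ ∀ x ∈ S, ∃! m, dist x (c m) ≤ δ := by
  have htrans : ∀ x y z : X, dist x y ≤ δ → dist y z ≤ δ → dist x z ≤ δ := fun x y z h1 h2 =>
    (dist_triangle_max x y z).trans (max_le h1 h2)
  let s : Setoid S :=
    { r := fun x y => dist (x : X) y ≤ δ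
      iseqv := ⟨fun x => by simpa using hδ.le, fun h => by rwa [dist_comm],
        fun h1 h2 => htrans _ _ _ h1 h2⟩ }
  obtain ⟨t, ht, hcover⟩ := Metric.totallyBounded_iff.1
    ((Metric.isCompact_of_isClosed_isBounded isClosed_closure hS.closure).totallyBounded.subset
      subset_closure) δ hδ
  have hex : ∀ a : Quotient s, ∃ y : t, dist (a.out : X) y ≤ δ := by
    intro a
    obtain ⟨y, hy, hxy⟩ := Set.mem_iUnion₂.1 (hcover a.out.2)
    exact ⟨⟨y, hy⟩, hxy.le⟩
  choose f hf using hex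
  have hinj : Function.Injective f := by
    intro a b hab
    rw [← a.out_eq, ← b.out_eq]
    refine Quotient.sound (htrans _ _ _ (hf a) ?_)
    rw [hab, dist_comm]
    exact hf b
  have := ht.to_subtype
  have : Finite (Quotient s) := Finite.of_injective f hinj
  let e := Finite.equivFin (Quotient s)
  refine ⟨_, fun m => (e.symm m).out, fun m => (e.symm m).out.2, fun x hx => ?_⟩
  refine ⟨e ⟦⟨x, hx⟩⟧, ?_, fun m hm => ?_⟩
  · have h : dist ((⟦⟨x, hx⟩⟧ : Quotient s).out : X) x ≤ δ :=
      Quotient.mk_out (s := s) ⟨x, hx⟩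
    simpa [dist_comm] using h
  · rw [← e.symm_apply_eq, ← (e.symm m).out_eq]
    refine Quotient.sound ?_
    change dist ((e.symm m).out : X) x ≤ δ
    rwa [dist_comm]

/-- Every test function `φ ∈ 𝒟(K)` admits a finite decomposition
`φ(ωξr) = φ(0)Δ_l(r) + Σ_{m=1}^M φ(ωξr_m)Δ_l(r - r_m)` valid for all `ω ∈ μ_{q-1}`,
`ξ ∈ Σ_n`, `r ∈ ℚ_p^{(+)}`, where `r_m ∈ ℚ_p^{(1)}` and `Δ_l` is the indicator of the
ball `{|z|_p ≤ p^l}`. -/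
theorem test_function_decomposition
    (p n q : ℕ) [Fact (Nat.Prime p)] (hp2 : p ≠ 2) (hn : 0 < n) (hpn : ¬ p ∣ n)
    (hq : q = p ^ n)
    (K : Type) [NormedField K] [Algebra ℚ_[p] K] [FiniteDimensional ℚ_[p] K]
    (hK : IsUnramifiedDeg p n K)
    (ω : K → K) (hω : IsTeich p q K ω)
    (φ : K → ℂ) (hφlc : IsLocallyConstant φ) (hφsupp : HasCompactSupport φ) :
    ∃ (l : ℤ) (M : ℕ) (rm : Fin M → ℚ_[p]),
      (∀ m : Fin M, rm m ∈ Qp1 p) ∧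
      ∀ w ∈ muRoots q K, ∀ ξ ∈ SigmaN p K ω, ∀ ρ ∈ QpPlus p,
        φ (w * ξ * algebraMap ℚ_[p] K ρ)
          = φ 0 * (if ‖ρ‖ ≤ (p : ℝ) ^ l then 1 else 0)
            + ∑ m : Fin M, φ (w * ξ * algebraMap ℚ_[p] K (rm m)) *
                (if ‖ρ - rm m‖ ≤ (p : ℝ) ^ l then 1 else 0) := by
  obtain ⟨hfin, hnorm, -⟩ := hK
  have hp : p.Prime := Fact.out
  have hp1 : (1 : ℝ) < p := by exact_mod_cast hp.one_lt
  obtain ⟨ε, hε, hconst⟩ := hφlc.exists_forall_dist_lt_eq hφsupp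
  obtain ⟨R, hR⟩ := hφsupp.isCompact.isBounded.exists_norm_le
  obtain ⟨k, hk⟩ := exists_pow_lt_of_lt_one (lt_min hε one_pos) (inv_lt_one_of_one_lt₀ hp1)
  obtain ⟨l, δ, hl, hδ0, hδε, hδ1⟩ :
      ∃ (l : ℤ) (δ : ℝ), (p : ℝ) ^ l = δ ∧ 0 < δ ∧ δ < ε ∧ δ < 1 :=
    ⟨-k, _, rfl, by positivity, by simpa using hk.trans_le (min_le_left _ _),
      by simpa using hk.trans_le (min_le_right _ _)⟩
  have hnm : ∀ w ∈ muRoots q K, ∀ ξ ∈ SigmaN p K ω, ∀ a : ℚ_[p],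
      ‖w * ξ * algebraMap ℚ_[p] K a‖ = ‖a‖ ^ n := by
    intro w hw ξ hξ a
    have hq0 : q - 1 ≠ 0 := by
      have := Nat.one_lt_pow hn.ne' hp.one_lt
      omega
    have hw1 : ‖w‖ = 1 := by
      rw [← pow_eq_one_iff_of_nonneg (norm_nonneg w) hq0, ← norm_pow, show w ^ (q - 1) = 1 from hw,
        norm_one]
    have hξ1 : ‖ξ‖ = 1 := by rw [hnorm, hξ.2.2, norm_one]
    rw [norm_mul, norm_mul, hw1, hξ1, one_mul, one_mul, hnorm, Algebra.norm_algebraMap, hfin,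
      norm_pow]
  have hclose : ∀ w ∈ muRoots q K, ∀ ξ ∈ SigmaN p K ω, ∀ a b : ℚ_[p], ‖a - b‖ ≤ δ →
      φ (w * ξ * algebraMap ℚ_[p] K a) = φ (w * ξ * algebraMap ℚ_[p] K b) := by
    intro w hw ξ hξ a b hab
    apply hconst
    rw [dist_eq_norm, ← mul_sub, ← map_sub, hnm w hw ξ hξ]
    exact (pow_le_of_le_one (norm_nonneg _) (hab.trans hδ1.le) hn.ne').trans_lt
      (hab.trans_lt hδε)
  have hfar : ∀ w ∈ muRoots q K, ∀ ξ ∈ SigmaN p K ω, ∀ a : ℚ_[p], max R 1 < ‖a‖ →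
      φ (w * ξ * algebraMap ℚ_[p] K a) = 0 := by
    intro w hw ξ hξ a ha
    refine image_eq_zero_of_notMem_tsupport fun hmem => ?_
    have h1 := hR _ hmem
    rw [hnm w hw ξ hξ] at h1
    have h2 := le_self_pow₀ ((le_max_right R 1).trans ha.le) hn.ne'
    exact absurd ((le_max_left R 1).trans_lt ha) (h2.trans h1).not_gt
  let S : Set ℚ_[p] := {a | a ∈ Qp1 p ∧ δ < ‖a‖ ∧ ‖a‖ ≤ max R 1}
  have hSb : Bornology.IsBounded S := isBounded_iff_forall_norm_le.2 ⟨_, fun a ha => ha.2.2⟩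
  obtain ⟨M, rm, hrm, huniq⟩ := exists_fin_representatives_closedBall hSb hδ0
  simp only [dist_eq_norm] at huniq
  refine ⟨l, M, rm, fun m => (hrm m).1, fun w hw ξ hξ ρ hρ => ?_⟩
  rw [hl]
  have htri : ∀ a b : ℚ_[p], ‖a‖ ≤ max ‖a - b‖ ‖b‖ := fun a b => by
    simpa using IsUltrametricDist.norm_add_le_max (a - b) b
  by_cases hsmall : ‖ρ‖ ≤ δ
  · rw [if_pos hsmall, Finset.sum_eq_zero, mul_one, add_zero, hclose w hw ξ hξ ρ 0 (by simpa),
      map_zero, mul_zero]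
    intro m _
    rw [if_neg, mul_zero]
    intro h
    have := htri (rm m) ρ
    rw [norm_sub_rev] at this
    exact (this.trans (max_le h hsmall)).not_gt (hrm m).2.1
  rw [if_neg hsmall, mul_zero, zero_add]
  by_cases hbig : ‖ρ‖ ≤ max R 1
  · have hρ1 : ρ ∈ Qp1 p := hρ.resolve_right fun h0 => hsmall (by
      rw [Set.mem_singleton_iff.1 h0, norm_zero]; exact hδ0.le)
    obtain ⟨m, hm, hm'⟩ := huniq ρ ⟨hρ1, not_le.1 hsmall, hbig⟩
    rw [Finset.sum_eq_single m, if_pos hm, mul_one]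
    · exact hclose w hw ξ hξ _ _ hm
    · intro b _ hb
      rw [if_neg (fun h => hb (hm' b h)), mul_zero]
    · simp
  · rw [hfar w hw ξ hξ ρ (not_le.1 hbig), Finset.sum_eq_zero]
    intro m _
    rw [if_neg, mul_zero]
    intro h
    exact hbig ((htri ρ (rm m)).trans
      (max_le (h.trans (hδ1.le.trans (le_max_right _ _))) (hrm m).2.2))
end
end
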